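/- arXiv:2511.16918 — 2 statements merged into one kernel-verified Lean document; each statement's English description precedes it below -/
import Mathlib

section
/- Let G = (V,E) be a finite simple graph with maximum degree at most Δ, where Δ ≥ 1 is an integer, and let 0 < ε < 1. If λ ≥ (2/ε)·(4Δ)^{2/ε}, then the expected size of a matching drawn from the Gibbs distribution μ_{G,λ} satisfies (Σ_{k≥0} k·m_k(G)·λ^k) / (Σ_{k≥0} m_k(G)·λ^k) ≥ (1 − ε)·ν(G). -/
open scoped Classical

namespace SensMatching

variable {V : Type*} [Fintype V] [DecidableEq V]

/-- `M` is a matching of `G`: a finset of edges of `G`, no two of which share an endpoint. -/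
def IsMatchingSet (G : SimpleGraph V) (M : Finset (Sym2 V)) : Prop :=
  (∀ e ∈ M, e ∈ G.edgeSet) ∧
    ∀ e ∈ M, ∀ f ∈ M, e ≠ f → ∀ v : V, v ∈ e → v ∉ f

/-- The finset of all matchings of `G`. -/
noncomputable def matchings (G : SimpleGraph V) : Finset (Finset (Sym2 V)) :=
  Finset.univ.filter fun M => IsMatchingSet G M

/-- `ν(G)`: the maximum size of a matching of `G`. -/
noncomputable def nu (G : SimpleGraph V) : ℕ :=
  (matchings G).sup Finset.card

/-- `m_k(G)`: the number of matchings of size `k` in `G`. -/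
noncomputable def numMatchings (G : SimpleGraph V) (k : ℕ) : ℕ :=
  ((matchings G).filter fun M => M.card = k).card

/-- The degree of a vertex `v` in `G`. -/
noncomputable def degr (G : SimpleGraph V) (v : V) : ℕ :=
  (Finset.univ.filter fun w => G.Adj v w).card

/-- The finset of edges of `G`. -/
noncomputable def edges (G : SimpleGraph V) : Finset (Sym2 V) :=
  Finset.univ.filter fun e => e ∈ G.edgeSet

/-- The partition function `Z_G(λ) = Σ_{M matching} λ^{|M|}`. -/
noncomputable def partitionFn (G : SimpleGraph V) (lam : ℝ) : ℝ :=
  ∑ M ∈ matchings G, lam ^ M.card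

/-- The probability, under the Gibbs distribution `μ_{G,λ}`, of the event `p`. -/
noncomputable def gibbsProb (G : SimpleGraph V) (lam : ℝ) (p : Finset (Sym2 V) → Prop) : ℝ :=
  (∑ M ∈ (matchings G).filter p, lam ^ M.card) / partitionFn G lam

/-- The law of `f M`, where `M` follows the Gibbs distribution `μ_{G,λ}` conditioned
on the event `p`. -/
noncomputable def condDistMap (G : SimpleGraph V) (lam : ℝ) (p : Finset (Sym2 V) → Prop)
    (f : Finset (Sym2 V) → Finset (Sym2 V)) (N : Finset (Sym2 V)) : ℝ :=
  (∑ M ∈ ((matchings G).filter p).filter fun M => f M = N, lam ^ M.card) /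
    ∑ M ∈ (matchings G).filter p, lam ^ M.card

/-- The Gibbs distribution `μ_{G,λ}` conditioned on the event `p`. -/
noncomputable def condDist (G : SimpleGraph V) (lam : ℝ) (p : Finset (Sym2 V) → Prop) :
    Finset (Sym2 V) → ℝ :=
  condDistMap G lam p id

/-- The Gibbs distribution `μ_{G,λ}` over matchings of `G`. -/
noncomputable def gibbsDist (G : SimpleGraph V) (lam : ℝ) : Finset (Sym2 V) → ℝ :=
  condDist G lam fun _ => True

/-- `V(M)`: the set of vertices covered by the edge set `M`. -/
noncomputable def coveredVerts (M : Finset (Sym2 V)) : Finset V :=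
  Finset.univ.filter fun v => ∃ e ∈ M, v ∈ e

/-- `N(i)`: the set of edges of `G` sharing an endpoint with `i`, excluding `i` itself. -/
def edgeNbhd (G : SimpleGraph V) (i : Sym2 V) : Set (Sym2 V) :=
  {e | e ∈ G.edgeSet ∧ e ≠ i ∧ ∃ v : V, v ∈ e ∧ v ∈ i}

/-- `π` is a coupling of the distributions `μ` and `μ'`. -/
def IsCoupling {α : Type*} [Fintype α] (π : α × α → ℝ) (μ μ' : α → ℝ) : Prop :=
  (∀ q, 0 ≤ π q) ∧ (∀ a, ∑ b, π (a, b) = μ a) ∧ ∀ b, ∑ a, π (a, b) = μ' b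

/-- The edge-Hamming distance `|M △ M'|`. -/
noncomputable def edist (M M' : Finset (Sym2 V)) : ℕ :=
  ((M \ M') ∪ (M' \ M)).card

/-- The vertex-Hamming distance `|V(M) △ V(M')|`. -/
noncomputable def vdist (M M' : Finset (Sym2 V)) : ℕ :=
  ((coveredVerts M \ coveredVerts M') ∪ (coveredVerts M' \ coveredVerts M)).card

/-- The vertex-Hamming distance ignoring the vertex `u`: `|(V(M) △ V(M')) \ {u}|`. -/
noncomputable def vdistErase (u : V) (M M' : Finset (Sym2 V)) : ℕ :=
  (((coveredVerts M \ coveredVerts M') ∪ (coveredVerts M' \ coveredVerts M)).erase u).card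

/-- `M` satisfies the vertex pinning `(Bp, Bm)`: every vertex of `Bp` is covered by `M`
and no vertex of `Bm` is covered by `M`. -/
def satisfiesPinning (M : Finset (Sym2 V)) (Bp Bm : Finset V) : Prop :=
  (∀ w ∈ Bp, w ∈ coveredVerts M) ∧ ∀ w ∈ Bm, w ∉ coveredVerts M

/-- The Wasserstein distance between `μ` and `μ'` with respect to the metric `d`:
the infimum over couplings of the expected distance. -/
noncomputable def wass {α : Type*} [Fintype α] (d : α → α → ℝ) (μ μ' : α → ℝ) : ℝ :=
  sInf {c : ℝ | ∃ π : α × α → ℝ, IsCoupling π μ μ' ∧ c = ∑ q : α × α, π q * d q.1 q.2}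

theorem mem_matchings {V : Type*} [Fintype V] [DecidableEq V] {G : SimpleGraph V}
    {M : Finset (Sym2 V)} : M ∈ matchings G ↔ IsMatchingSet G M := by
  simp [matchings]

theorem card_le_nu {V : Type*} [Fintype V] [DecidableEq V] {G : SimpleGraph V}
    {M : Finset (Sym2 V)} (hM : M ∈ matchings G) : M.card ≤ nu G :=
  Finset.le_sup (f := Finset.card) hM

theorem empty_mem_matchings {V : Type*} [Fintype V] [DecidableEq V] (G : SimpleGraph V) :
    ∅ ∈ matchings G := by
  simp [mem_matchings, IsMatchingSet]

theorem exists_card_eq_nu {V : Type*} [Fintype V] [DecidableEq V] (G : SimpleGraph V) :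
    ∃ M ∈ matchings G, M.card = nu G := by
  obtain ⟨M, hM, h⟩ := Finset.exists_mem_eq_sup (matchings G) ⟨∅, empty_mem_matchings G⟩
    Finset.card
  exact ⟨M, hM, h.symm⟩

theorem card_coveredVerts_le {V : Type*} [Fintype V] [DecidableEq V] (M : Finset (Sym2 V)) :
    (coveredVerts M).card ≤ 2 * M.card := by
  have hsub : coveredVerts M ⊆ M.biUnion fun e => e.toFinset := by
    intro v hv
    simpa [coveredVerts] using hv
  refine (Finset.card_le_card hsub).trans (Finset.card_biUnion_le.trans ?_)
  rw [mul_comm]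
  refine (Finset.sum_le_card_nsmul M _ 2 fun e _ => ?_).trans_eq (smul_eq_mul _ _)
  rw [Sym2.card_toFinset]
  split_ifs <;> omega

/-- The covered vertices of a maximum matching form a vertex cover. -/
theorem exists_mem_coveredVerts {V : Type*} [Fintype V] [DecidableEq V] {G : SimpleGraph V}
    {M : Finset (Sym2 V)} (hM : M ∈ matchings G) (hcard : M.card = nu G) {e : Sym2 V}
    (he : e ∈ G.edgeSet) : ∃ v ∈ e, v ∈ coveredVerts M := by
  by_contra! h
  have h' : ∀ v ∈ e, ∀ f ∈ M, v ∉ f := by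
    intro v hv f hf hvf
    exact h v hv (by simpa [coveredVerts] using ⟨f, hf, hvf⟩)
  have heM : e ∉ M := fun hmem => h' _ e.out_fst_mem e hmem e.out_fst_mem
  have hins : insert e M ∈ matchings G := by
    rw [mem_matchings] at hM ⊢
    refine ⟨fun f hf => ?_, fun f hf g hg hfg v hvf hvg => ?_⟩
    · rcases Finset.mem_insert.1 hf with rfl | hf
      exacts [he, hM.1 f hf]
    · rcases Finset.mem_insert.1 hf with rfl | hfM <;>
        rcases Finset.mem_insert.1 hg with rfl | hgM
      · exact hfg rfl
      · exact h' v hvf g hgM hvg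
      · exact h' v hvg f hfM hvf
      · exact hM.2 f hfM g hgM hfg v hvf hvg
  have := card_le_nu hins
  rw [Finset.card_insert_of_notMem heM] at this
  omega

theorem card_matchings_le {V : Type*} [Fintype V] [DecidableEq V] (G : SimpleGraph V) {Δ : ℕ}
    (hdeg : ∀ v : V, degr G v ≤ Δ) : (matchings G).card ≤ (1 + Δ) ^ (2 * nu G) := by
  obtain ⟨M₀, hM₀, hcard⟩ := exists_card_eq_nu G
  let C := coveredVerts M₀
  let T : V → Finset (Finset V) := fun v =>
    insert ∅ ((Finset.univ.filter fun w => G.Adj v w).image fun w => {w})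
  let F : Finset (Sym2 V) → (v : V) → v ∈ C → Finset V := fun M v _ =>
    Finset.univ.filter fun w => s(v, w) ∈ M
  have hT : ∀ v, (T v).card ≤ 1 + Δ := by
    intro v
    have h1 := Finset.card_insert_le (∅ : Finset V)
      ((Finset.univ.filter fun w => G.Adj v w).image fun w => ({w} : Finset V))
    have h2 := Finset.card_image_le (s := Finset.univ.filter fun w => G.Adj v w)
      (f := fun w => ({w} : Finset V))
    have h3 : (Finset.univ.filter fun w => G.Adj v w).card ≤ Δ := hdeg v
    simp only [T]
    omega
  have hmaps : ∀ M ∈ matchings G, F M ∈ C.pi T := by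
    intro M hM
    rw [mem_matchings] at hM
    refine Finset.mem_pi.2 fun v _ => ?_
    simp only [T, Finset.mem_insert, Finset.mem_image, Finset.mem_filter, Finset.mem_univ,
      true_and]
    refine (Finset.eq_empty_or_nonempty _).imp id ?_
    rintro ⟨w, hw⟩
    have hw : s(v, w) ∈ M := by simpa [F] using hw
    refine ⟨w, hM.1 _ hw, ?_⟩
    ext x
    simp only [F, Finset.mem_singleton, Finset.mem_filter, Finset.mem_univ, true_and]
    refine ⟨fun h => h ▸ hw, fun hx => ?_⟩
    by_contra hne
    exact hM.2 _ hx _ hw (fun h => hne (Sym2.congr_right.1 h)) v (Sym2.mem_mk_left _ _)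
      (Sym2.mem_mk_left _ _)
  have hsub : ∀ M ∈ matchings G, ∀ M', F M = F M' → M ⊆ M' := by
    intro M hM M' hF e he
    obtain ⟨v, hve, hvC⟩ :=
      exists_mem_coveredVerts hM₀ hcard ((mem_matchings.1 hM).1 e he)
    obtain ⟨w, rfl⟩ := hve
    have hw : w ∈ F M v hvC := by simpa [F] using he
    rw [hF] at hw
    simpa [F] using hw
  have hinj : Set.InjOn F (matchings G) := fun M hM M' hM' h =>
    (hsub M hM M' h).antisymm (hsub M' hM' M h.symm)
  calc (matchings G).card ≤ (C.pi T).card := Finset.card_le_card_of_injOn F hmaps hinj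
    _ = ∏ v ∈ C, (T v).card := Finset.card_pi _ _
    _ ≤ (1 + Δ) ^ C.card := Finset.prod_le_pow_card _ _ _ fun v _ => hT v
    _ ≤ (1 + Δ) ^ (2 * nu G) :=
      Nat.pow_le_pow_right (by omega) (hcard ▸ card_coveredVerts_le M₀)

theorem sum_numMatchings {V : Type*} [Fintype V] [DecidableEq V] (G : SimpleGraph V)
    (g : ℕ → ℝ) :
    ∑ k ∈ Finset.range (nu G + 1), (numMatchings G k : ℝ) * g k =
      ∑ M ∈ matchings G, g M.card := by
  rw [← Finset.sum_fiberwise_of_maps_to (g := Finset.card) (t := Finset.range (nu G + 1))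
    fun M hM => Finset.mem_range.2 (Nat.lt_succ_of_le (card_le_nu hM))]
  refine Finset.sum_congr rfl fun k _ => ?_
  rw [Finset.sum_congr rfl fun M hM => by rw [(Finset.mem_filter.1 hM).2], Finset.sum_const,
    nsmul_eq_mul, numMatchings]

/-- The entropy of a probability distribution on `s` is at most `log |s|`, stated for the
distribution with unnormalized weights `w`. -/
theorem sum_mul_log_sub_log_card_le {α : Type*} {s : Finset α} (hs : s.Nonempty) {w : α → ℝ}
    (hw : ∀ a ∈ s, 0 < w a) :
    (∑ a ∈ s, w a) * (Real.log (∑ a ∈ s, w a) - Real.log s.card) ≤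
      ∑ a ∈ s, w a * Real.log (w a) := by
  have hZ : 0 < ∑ a ∈ s, w a := Finset.sum_pos hw hs
  have hN : (0 : ℝ) < s.card := by exact_mod_cast hs.card_pos
  set Z := ∑ a ∈ s, w a with hZdef
  have key : ∀ a ∈ s,
      w a * (Real.log Z - Real.log s.card) - w a * Real.log (w a) ≤ Z / s.card - w a := by
    intro a ha
    have hwa := hw a ha
    have h := Real.log_le_sub_one_of_pos (div_pos (div_pos hZ hN) hwa)
    rw [Real.log_div (div_pos hZ hN).ne' hwa.ne', Real.log_div hZ.ne' hN.ne'] at h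
    have h2 := mul_le_mul_of_nonneg_left h hwa.le
    rw [mul_sub, mul_sub (w a) (_ / _), mul_div_cancel₀ _ hwa.ne'] at h2
    linarith
  have hsum := Finset.sum_le_sum key
  rw [Finset.sum_sub_distrib, Finset.sum_sub_distrib, ← Finset.sum_mul, Finset.sum_const,
    nsmul_eq_mul, mul_div_cancel₀ _ hN.ne', ← hZdef] at hsum
  linarith

/-- if `λ ≥ (2/ε)·(4Δ)^{2/ε}`, the expected matching size under the Gibbs
distribution `μ_{G,λ}` is at least `(1 − ε)·ν(G)`. -/
theorem stmt_1 {V : Type*} [Fintype V] [DecidableEq V]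
    (G : SimpleGraph V) (Δ : ℕ) (hΔ : 1 ≤ Δ) (hdeg : ∀ v : V, degr G v ≤ Δ)
    (ε lam : ℝ) (hε0 : 0 < ε) (hε1 : ε < 1) (hlam0 : 0 < lam)
    (hlam : 2 / ε * (4 * (Δ : ℝ)) ^ ((2 : ℝ) / ε) ≤ lam) :
    (1 - ε) * (nu G : ℝ) ≤
      (∑ k ∈ Finset.range (nu G + 1), (k : ℝ) * (numMatchings G k : ℝ) * lam ^ k) /
        ∑ k ∈ Finset.range (nu G + 1), (numMatchings G k : ℝ) * lam ^ k := by
  have hΔ' : (1 : ℝ) ≤ Δ := by exact_mod_cast hΔ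
  have hbase : (1 + (Δ : ℝ)) ^ ((2 : ℝ) / ε) ≤ lam := by
    have h1 : (1 + (Δ : ℝ)) ^ ((2 : ℝ) / ε) ≤ (4 * (Δ : ℝ)) ^ ((2 : ℝ) / ε) :=
      Real.rpow_le_rpow (by linarith) (by linarith) (by positivity)
    have h2 : 1 ≤ 2 / ε := by rw [le_div_iff₀ hε0]; linarith
    have h3 : 0 ≤ (4 * (Δ : ℝ)) ^ ((2 : ℝ) / ε) := by positivity
    nlinarith
  have hlog : 2 * Real.log (1 + Δ) ≤ ε * Real.log lam := by
    have h := Real.log_le_log (by positivity) hbase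
    rw [Real.log_rpow (by linarith), div_mul_eq_mul_div, div_le_iff₀ hε0] at h
    linarith
  have hlogΔ : 0 < Real.log (1 + Δ) := Real.log_pos (by linarith)
  have hL : 0 < Real.log lam := by
    by_contra! h
    nlinarith
  have hne : (matchings G).Nonempty := ⟨∅, empty_mem_matchings G⟩
  have hw : ∀ M ∈ matchings G, 0 < lam ^ M.card := fun M _ => pow_pos hlam0 _
  have hZ : 0 < ∑ M ∈ matchings G, lam ^ M.card := Finset.sum_pos hw hne
  have hN : (0 : ℝ) < (matchings G).card := by exact_mod_cast hne.card_pos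
  have hentropy := sum_mul_log_sub_log_card_le hne hw
  have hlogN : Real.log (matchings G).card ≤ 2 * nu G * Real.log (1 + Δ) := by
    have h : ((matchings G).card : ℝ) ≤ (1 + Δ) ^ (2 * nu G) := by
      exact_mod_cast card_matchings_le G hdeg
    simpa [Real.log_pow] using Real.log_le_log hN h
  have hlogZ : nu G * Real.log lam ≤ Real.log (∑ M ∈ matchings G, lam ^ M.card) := by
    obtain ⟨M, hM, hcard⟩ := exists_card_eq_nu G
    rw [← Real.log_pow, ← hcard]
    exact Real.log_le_log (hw M hM)
      (Finset.single_le_sum (f := fun M => lam ^ M.card) (fun M hM => (hw M hM).le) hM)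
  have hnum : ∑ k ∈ Finset.range (nu G + 1), (k : ℝ) * (numMatchings G k : ℝ) * lam ^ k =
      ∑ M ∈ matchings G, (M.card : ℝ) * lam ^ M.card := by
    rw [← sum_numMatchings G fun k => (k : ℝ) * lam ^ k]
    exact Finset.sum_congr rfl fun k _ => by ring
  rw [hnum, sum_numMatchings G fun k => lam ^ k, le_div_iff₀ hZ]
  have hright : ∑ M ∈ matchings G, lam ^ M.card * Real.log (lam ^ M.card) =
      (∑ M ∈ matchings G, (M.card : ℝ) * lam ^ M.card) * Real.log lam := by
    rw [Finset.sum_mul]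
    exact Finset.sum_congr rfl fun M _ => by rw [Real.log_pow]; ring
  rw [hright] at hentropy
  have hexp : (1 - ε) * nu G * Real.log lam ≤
      Real.log (∑ M ∈ matchings G, lam ^ M.card) - Real.log (matchings G).card := by
    have h := mul_le_mul_of_nonneg_left hlog (Nat.cast_nonneg (α := ℝ) (nu G))
    linarith
  refine le_of_mul_le_mul_right ?_ hL
  have h := mul_le_mul_of_nonneg_left hexp hZ.le
  linarith

end SensMatching
end

section
/- Let G = (V,E) be a finite simple graph with maximum degree at most Δ (Δ ≥ 1), let λ > 0, and let i ∈ E be a pendant edge (one of its endpoints has degree 1). Let M ∼ μ_{G,λ}. Then there exists a coupling π of the conditional law of M∖{i} given i ∈ M and the conditional law of M given i ∉ M such that E_{(N,N') ∼ π}[|N △ N'|] ≤ λΔ. -/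
open scoped Classical

namespace SensMatching

variable {V : Type*} [Fintype V] [DecidableEq V]

/-- The matchings of `G` none of whose edges touches `D`. -/
noncomputable def avoiding (G : SimpleGraph V) (D : Finset V) : Finset (Finset (Sym2 V)) :=
  (matchings G).filter fun M => ∀ e ∈ M, ∀ x ∈ D, x ∉ e

/-- The total weight of the matchings of `G` avoiding `D`. -/
noncomputable def avoidingZ (G : SimpleGraph V) (lam : ℝ) (D : Finset V) : ℝ :=
  ∑ M ∈ avoiding G D, lam ^ M.card

/-- The Gibbs distribution over the matchings of `G` avoiding `D`. -/
noncomputable def avoidingDist (G : SimpleGraph V) (lam : ℝ) (D : Finset V)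
    (N : Finset (Sym2 V)) : ℝ :=
  (if N ∈ avoiding G D then lam ^ N.card else 0) / avoidingZ G lam D

/-- The neighbours of `v` outside `D`. -/
noncomputable def nbrsOutside (G : SimpleGraph V) (D : Finset V) (v : V) : Finset V :=
  Finset.univ.filter fun w => G.Adj v w ∧ w ∉ D

theorem mem_avoiding {G : SimpleGraph V} {D : Finset V} {M : Finset (Sym2 V)} :
    M ∈ avoiding G D ↔ IsMatchingSet G M ∧ ∀ e ∈ M, ∀ x ∈ D, x ∉ e := by
  simp [avoiding, matchings]

theorem IsMatchingSet.subset {G : SimpleGraph V} {M N : Finset (Sym2 V)}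
    (hM : IsMatchingSet G M) (h : N ⊆ M) : IsMatchingSet G N :=
  ⟨fun e he => hM.1 e (h he), fun e he f hf => hM.2 e (h he) f (h hf)⟩

theorem IsMatchingSet.insert_edge {G : SimpleGraph V} {M : Finset (Sym2 V)} {v w : V}
    (hM : IsMatchingSet G M) (hadj : G.Adj v w) (hv : ∀ e ∈ M, v ∉ e) (hw : ∀ e ∈ M, w ∉ e) :
    IsMatchingSet G (insert s(v, w) M) := by
  refine ⟨fun e he => ?_, fun e he f hf hne x hxe hxf => ?_⟩
  · rcases Finset.mem_insert.1 he with rfl | he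
    · exact hadj
    · exact hM.1 e he
  · rcases Finset.mem_insert.1 he with rfl | heM <;>
      rcases Finset.mem_insert.1 hf with rfl | hfM
    · exact hne rfl
    · rcases Sym2.mem_iff.1 hxe with rfl | rfl
      exacts [hv f hfM hxf, hw f hfM hxf]
    · rcases Sym2.mem_iff.1 hxf with rfl | rfl
      exacts [hv e heM hxe, hw e heM hxe]
    · exact hM.2 e heM f hfM hne x hxe hxf

theorem avoiding_anti {G : SimpleGraph V} {D D' : Finset V} (h : D ⊆ D') :
    avoiding G D' ⊆ avoiding G D := fun M hM => by
  rw [mem_avoiding] at hM ⊢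
  exact ⟨hM.1, fun e he x hx => hM.2 e he x (h hx)⟩

theorem avoidingZ_anti (G : SimpleGraph V) {lam : ℝ} (hlam : 0 < lam) {D D' : Finset V}
    (h : D ⊆ D') : avoidingZ G lam D' ≤ avoidingZ G lam D :=
  Finset.sum_le_sum_of_subset_of_nonneg (avoiding_anti h) fun _ _ _ => by positivity

theorem avoidingZ_pos (G : SimpleGraph V) {lam : ℝ} (hlam : 0 < lam) (D : Finset V) :
    0 < avoidingZ G lam D :=
  Finset.sum_pos (fun _ _ => by positivity)
    ⟨∅, mem_avoiding.2 ⟨⟨by simp, by simp⟩, by simp⟩⟩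

theorem avoidingDist_nonneg (G : SimpleGraph V) {lam : ℝ} (hlam : 0 < lam) (D : Finset V)
    (N : Finset (Sym2 V)) : 0 ≤ avoidingDist G lam D N := by
  have := avoidingZ_pos G hlam D
  unfold avoidingDist
  split_ifs <;> positivity

theorem sum_avoidingDist (G : SimpleGraph V) {lam : ℝ} (hlam : 0 < lam) (D : Finset V) :
    ∑ N, avoidingDist G lam D N = 1 := by
  unfold avoidingDist
  rw [← Finset.sum_div, div_eq_one_iff_eq (avoidingZ_pos G hlam D).ne', Finset.sum_ite_mem,
    Finset.univ_inter, avoidingZ]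

theorem not_mem_of_avoiding {G : SimpleGraph V} {D : Finset V} {M : Finset (Sym2 V)} {v w : V}
    (hM : M ∈ avoiding G D) (hv : v ∈ D) : s(v, w) ∉ M := fun h =>
  (mem_avoiding.1 hM).2 _ h v hv (Sym2.mem_mk_left v w)

/-- Splitting the matchings avoiding `D` according to the partner of `v`. -/
theorem sum_avoiding_eq (G : SimpleGraph V) (D : Finset V) {v : V} (hv : v ∉ D)
    (F : Finset (Sym2 V) → ℝ) :
    ∑ M ∈ avoiding G D, F M = ∑ M ∈ avoiding G (insert v D), F M +
      ∑ w ∈ nbrsOutside G D v, ∑ M ∈ avoiding G (insert w (insert v D)),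
        F (insert s(v, w) M) := by
  have key : avoiding G D = avoiding G (insert v D) ∪
      (nbrsOutside G D v).biUnion fun w =>
        (avoiding G (insert w (insert v D))).image (insert s(v, w)) := by
    ext M
    simp only [Finset.mem_union, Finset.mem_biUnion, Finset.mem_image]
    constructor
    · intro hM
      rw [mem_avoiding] at hM
      by_cases hc : ∃ e ∈ M, v ∈ e
      · obtain ⟨e, he, hve⟩ := hc
        obtain ⟨w, rfl⟩ := hve
        right
        refine ⟨w, ?_, M.erase s(v, w), ?_, Finset.insert_erase he⟩
        · simp only [nbrsOutside, Finset.mem_filter, Finset.mem_univ, true_and]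
          exact ⟨hM.1.1 _ he, fun hw => hM.2 _ he w hw (Sym2.mem_mk_right v w)⟩
        · rw [mem_avoiding]
          refine ⟨hM.1.subset (Finset.erase_subset _ _), fun e hee x hx hxe => ?_⟩
          obtain ⟨hne, heM⟩ := Finset.mem_erase.1 hee
          rcases Finset.mem_insert.1 hx with rfl | hx
          · exact hM.1.2 e heM _ he hne x hxe (Sym2.mem_mk_right v x)
          rcases Finset.mem_insert.1 hx with rfl | hx
          · exact hM.1.2 e heM _ he hne x hxe (Sym2.mem_mk_left x w)
          · exact hM.2 e heM x hx hxe
      · push Not at hc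
        left
        rw [mem_avoiding]
        refine ⟨hM.1, fun e he x hx => ?_⟩
        rcases Finset.mem_insert.1 hx with rfl | hx
        exacts [hc e he, hM.2 e he x hx]
    · rintro (hM | ⟨w, hw, N, hN, rfl⟩)
      · exact avoiding_anti (Finset.subset_insert _ _) hM
      · simp only [nbrsOutside, Finset.mem_filter, Finset.mem_univ, true_and] at hw
        rw [mem_avoiding] at hN ⊢
        refine ⟨hN.1.insert_edge hw.1 (fun e he => hN.2 e he v (by simp))
          (fun e he => hN.2 e he w (by simp)), fun e he x hx hxe => ?_⟩
        rcases Finset.mem_insert.1 he with rfl | he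
        · rcases Sym2.mem_iff.1 hxe with rfl | rfl
          exacts [hv hx, hw.2 hx]
        · exact hN.2 e he x (by simp [hx]) hxe
  have inj : ∀ w, Set.InjOn (insert s(v, w)) (↑(avoiding G (insert w (insert v D))) :
      Set (Finset (Sym2 V))) := by
    intro w M hM N hN h
    have hv' : v ∈ insert w (insert v D) := by simp
    rw [← Finset.erase_insert (not_mem_of_avoiding (w := w) hM hv'),
      ← Finset.erase_insert (not_mem_of_avoiding (w := w) hN hv')]
    exact congrArg (fun A => Finset.erase A s(v, w)) h
  rw [key, Finset.sum_union, Finset.sum_biUnion]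
  · congr 1
    exact Finset.sum_congr rfl fun w _ => Finset.sum_image (inj w)
  · intro w _ w' _ hne
    simp only [Function.onFun]
    rw [Finset.disjoint_left]
    intro M hM hM'
    simp only [Finset.mem_image] at hM hM'
    obtain ⟨N, -, rfl⟩ := hM
    obtain ⟨N', hN', h⟩ := hM'
    have hmem : s(v, w) ∈ insert s(v, w') N' := h ▸ Finset.mem_insert_self _ _
    rcases Finset.mem_insert.1 hmem with h1 | h1
    · exact hne (Sym2.congr_right.1 h1)
    · exact not_mem_of_avoiding hN' (by simp) h1
  · rw [Finset.disjoint_left]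
    intro M hM hM'
    simp only [Finset.mem_biUnion, Finset.mem_image] at hM'
    obtain ⟨w, -, N, -, rfl⟩ := hM'
    exact not_mem_of_avoiding hM (Finset.mem_insert_self v D) (Finset.mem_insert_self _ _)

theorem avoidingZ_eq (G : SimpleGraph V) (lam : ℝ) (D : Finset V) {v : V} (hv : v ∉ D) :
    avoidingZ G lam D = avoidingZ G lam (insert v D) +
      ∑ w ∈ nbrsOutside G D v, lam * avoidingZ G lam (insert w (insert v D)) := by
  unfold avoidingZ
  rw [sum_avoiding_eq G D hv]
  congr 1
  refine Finset.sum_congr rfl fun w _ => ?_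
  rw [Finset.mul_sum]
  refine Finset.sum_congr rfl fun M hM => ?_
  rw [Finset.card_insert_of_notMem (not_mem_of_avoiding hM (by simp)), pow_succ']

theorem avoidingDist_eq (G : SimpleGraph V) {lam : ℝ} (hlam : 0 < lam) (D : Finset V) {v : V}
    (hv : v ∉ D) (N : Finset (Sym2 V)) :
    avoidingDist G lam D N =
      avoidingZ G lam (insert v D) / avoidingZ G lam D * avoidingDist G lam (insert v D) N +
      ∑ w ∈ nbrsOutside G D v,
        lam * avoidingZ G lam (insert w (insert v D)) / avoidingZ G lam D *
          ∑ M, if insert s(v, w) M = N then avoidingDist G lam (insert w (insert v D)) M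
            else 0 := by
  have hind : ∀ D : Finset V, (if N ∈ avoiding G D then lam ^ N.card else 0) =
      ∑ M ∈ avoiding G D, if M = N then lam ^ M.card else 0 := fun D => by
    rw [Finset.sum_ite_eq']
  have hZ := (avoidingZ_pos G hlam D).ne'
  have hZ1 := (avoidingZ_pos G hlam (insert v D)).ne'
  unfold avoidingDist
  rw [hind D, hind (insert v D), sum_avoiding_eq G D hv, add_div]
  congr 1
  · field_simp
  rw [Finset.sum_div]
  refine Finset.sum_congr rfl fun w _ => ?_
  have hZ2 := (avoidingZ_pos G hlam (insert w (insert v D))).ne'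
  have : (∑ M, if insert s(v, w) M = N then
      (if M ∈ avoiding G (insert w (insert v D)) then lam ^ M.card else 0) /
        avoidingZ G lam (insert w (insert v D)) else 0) =
      (∑ M ∈ avoiding G (insert w (insert v D)),
        if insert s(v, w) M = N then lam ^ M.card else 0) /
        avoidingZ G lam (insert w (insert v D)) := by
    rw [Finset.sum_div, ← Finset.univ_inter (avoiding G _), ← Finset.sum_ite_mem]
    refine Finset.sum_congr rfl fun M _ => ?_
    rw [Finset.univ_inter]
    split_ifs <;> simp
  rw [this]
  have h2 : (∑ M ∈ avoiding G (insert w (insert v D)),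
      if insert s(v, w) M = N then lam ^ (insert s(v, w) M).card else 0) =
      lam * ∑ M ∈ avoiding G (insert w (insert v D)),
        if insert s(v, w) M = N then lam ^ M.card else 0 := by
    rw [Finset.mul_sum]
    refine Finset.sum_congr rfl fun M hM => ?_
    rw [Finset.card_insert_of_notMem (not_mem_of_avoiding hM (by simp)), pow_succ']
    split_ifs <;> simp
  rw [h2]
  field_simp

/-- Coupling a distribution with a mixture of itself and of images of distributions already
coupled with it. -/
theorem exists_coupling_mixture {α ι : Type*} [Fintype α] (s : Finset ι) (d : α → α → ℝ)
    (p₀ C : ℝ) (p : ι → ℝ) (f : ι → α → α) (μ μ' : α → ℝ) (ν : ι → α → ℝ)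
    (hd : ∀ a, d a a = 0) (hdf : ∀ j ∈ s, ∀ a c, d a (f j c) ≤ 1 + d c a)
    (hp₀ : 0 ≤ p₀) (hp : ∀ j ∈ s, 0 ≤ p j) (hsum : p₀ + ∑ j ∈ s, p j = 1)
    (hμ : ∀ a, 0 ≤ μ a) (hμ1 : ∑ a, μ a = 1)
    (hμ' : ∀ b, μ' b = p₀ * μ b + ∑ j ∈ s, p j * ∑ c, if f j c = b then ν j c else 0)
    (hπ : ∀ j ∈ s, ∃ π : α × α → ℝ, IsCoupling π (ν j) μ ∧ ∑ q, π q * d q.1 q.2 ≤ C) :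
    ∃ π : α × α → ℝ, IsCoupling π μ μ' ∧
      ∑ q, π q * d q.1 q.2 ≤ (∑ j ∈ s, p j) * (1 + C) := by
  choose! π hπc hπC using hπ
  refine ⟨fun q => p₀ * (if q.1 = q.2 then μ q.1 else 0) +
    ∑ j ∈ s, p j * ∑ c, if f j c = q.2 then π j (c, q.1) else 0, ⟨?_, ?_, ?_⟩, ?_⟩
  · intro q
    refine add_nonneg (mul_nonneg hp₀ (by split_ifs <;> simp [hμ])) ?_
    refine Finset.sum_nonneg fun j hj => mul_nonneg (hp j hj) (Finset.sum_nonneg fun c _ => ?_)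
    split_ifs
    exacts [(hπc j hj).1 _, le_rfl]
  · intro a
    rw [Finset.sum_add_distrib, ← Finset.mul_sum, Finset.sum_comm]
    have : ∀ j ∈ s, (∑ b, p j * ∑ c, if f j c = b then π j (c, a) else 0) = p j * μ a := by
      intro j hj
      rw [← Finset.mul_sum, Finset.sum_comm, ← (hπc j hj).2.2 a]
      simp
    rw [Finset.sum_congr rfl this, ← Finset.sum_mul]
    simp only [Finset.sum_ite_eq, Finset.mem_univ, if_true]
    rw [← add_mul, hsum, one_mul]
  · intro b
    rw [Finset.sum_add_distrib, ← Finset.mul_sum, Finset.sum_comm, hμ' b]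
    congr 1
    · simp
    · refine Finset.sum_congr rfl fun j hj => ?_
      rw [← Finset.mul_sum, Finset.sum_comm]
      congr 1
      refine Finset.sum_congr rfl fun c _ => ?_
      split_ifs
      exacts [(hπc j hj).2.1 c, by simp]
  · have hcost : ∀ j ∈ s, ∑ a, ∑ b, (∑ c, if f j c = b then π j (c, a) else 0) * d a b ≤
        1 + C := by
      intro j hj
      have h1 : ∑ a, ∑ b, (∑ c, if f j c = b then π j (c, a) else 0) * d a b =
          ∑ a, ∑ c, π j (c, a) * d a (f j c) := by
        refine Finset.sum_congr rfl fun a _ => ?_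
        simp only [Finset.sum_mul]
        rw [Finset.sum_comm]
        simp [ite_mul]
      have h2 : ∑ a, ∑ c, π j (c, a) * d a (f j c) ≤ ∑ a, ∑ c, π j (c, a) * (1 + d c a) :=
        Finset.sum_le_sum fun a _ => Finset.sum_le_sum fun c _ =>
          mul_le_mul_of_nonneg_left (hdf j hj a c) ((hπc j hj).1 _)
      have h3 : ∑ a, ∑ c, π j (c, a) * (1 + d c a) = 1 + ∑ q, π j q * d q.1 q.2 := by
        rw [Fintype.sum_prod_type, Finset.sum_comm (f := fun x y => π j (x, y) * _)]
        simp only [mul_add, mul_one, Finset.sum_add_distrib]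
        rw [Finset.sum_congr rfl fun a _ => (hπc j hj).2.2 a, hμ1]
      linarith [hπC j hj]
    calc _ = ∑ j ∈ s, p j * ∑ a, ∑ b, (∑ c, if f j c = b then π j (c, a) else 0) * d a b := by
          rw [Fintype.sum_prod_type]
          simp only [add_mul, Finset.sum_add_distrib, Finset.sum_mul, Finset.mul_sum]
          rw [← zero_add (∑ j ∈ s, _)]
          congr 1
          · refine Finset.sum_eq_zero fun a _ => Finset.sum_eq_zero fun b _ => ?_
            split_ifs with h
            · simp [h, hd]
            · simp
          · simp only [Finset.sum_comm (s := s), mul_assoc]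
      _ ≤ ∑ j ∈ s, p j * (1 + C) :=
          Finset.sum_le_sum fun j hj => mul_le_mul_of_nonneg_left (hcost j hj) (hp j hj)
      _ = _ := by rw [Finset.sum_mul]

theorem edist_self (M : Finset (Sym2 V)) : edist M M = 0 := by simp [edist]

theorem edist_insert_le (e : Sym2 V) (M N : Finset (Sym2 V)) :
    edist M (insert e N) ≤ 1 + edist N M := by
  unfold edist
  rw [add_comm]
  refine le_trans (Finset.card_le_card ?_) (Finset.card_insert_le e _)
  intro x
  simp only [Finset.mem_union, Finset.mem_sdiff, Finset.mem_insert]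
  tauto

theorem exists_coupling_avoiding (G : SimpleGraph V) (Δ : ℕ) (hdeg : ∀ v : V, degr G v ≤ Δ)
    {lam : ℝ} (hlam : 0 < lam) (D : Finset V) {v : V} (hv : v ∉ D) :
    ∃ π : Finset (Sym2 V) × Finset (Sym2 V) → ℝ,
      IsCoupling π (avoidingDist G lam (insert v D)) (avoidingDist G lam D) ∧
      ∑ q : Finset (Sym2 V) × Finset (Sym2 V), π q * (edist q.1 q.2 : ℝ) ≤
        lam * (Δ : ℝ) := by
  induction hn : (Finset.univ \ D).card using Nat.strong_induction_on generalizing D v with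
  | _ n ih =>
    subst hn
    have hZ := avoidingZ_pos G hlam D
    have hZ1 := avoidingZ_pos G hlam (insert v D)
    obtain ⟨π, hπ, hcost⟩ := exists_coupling_mixture (nbrsOutside G D v)
      (fun M N => (edist M N : ℝ)) (avoidingZ G lam (insert v D) / avoidingZ G lam D)
      (lam * Δ) (fun w => lam * avoidingZ G lam (insert w (insert v D)) / avoidingZ G lam D)
      (fun w => insert s(v, w)) (avoidingDist G lam (insert v D)) (avoidingDist G lam D)
      (fun w => avoidingDist G lam (insert w (insert v D)))
      (fun M => by simp [edist_self])
      (fun w _ M N => by exact_mod_cast edist_insert_le s(v, w) M N)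
      (by positivity)
      (fun w _ => by have := avoidingZ_pos G hlam (insert w (insert v D)); positivity)
      (by
        rw [← Finset.sum_div, ← add_div, ← avoidingZ_eq G lam D hv, div_self hZ.ne'])
      (avoidingDist_nonneg G hlam _) (sum_avoidingDist G hlam _)
      (fun N => by convert avoidingDist_eq G hlam D hv N)
      (fun w hw => by
        simp only [nbrsOutside, Finset.mem_filter, Finset.mem_univ, true_and] at hw
        refine ih _ (Finset.card_lt_card ?_) (insert v D) (v := w) ?_ rfl
        · rw [Finset.ssubset_iff_of_subset
            (Finset.sdiff_subset_sdiff le_rfl (Finset.subset_insert v D))]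
          exact ⟨v, by simp [hv], by simp⟩
        · simp [hw.2, hw.1.ne'])
    refine ⟨π, hπ, hcost.trans ?_⟩
    have hbound : ∑ w ∈ nbrsOutside G D v, lam * avoidingZ G lam (insert w (insert v D)) ≤
        lam * Δ * avoidingZ G lam (insert v D) := by
      calc _ ≤ ∑ w ∈ nbrsOutside G D v, lam * avoidingZ G lam (insert v D) :=
            Finset.sum_le_sum fun w _ => mul_le_mul_of_nonneg_left
              (avoidingZ_anti G hlam (Finset.subset_insert _ _)) hlam.le
        _ = (nbrsOutside G D v).card * (lam * avoidingZ G lam (insert v D)) := by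
            rw [Finset.sum_const, nsmul_eq_mul]
        _ ≤ Δ * (lam * avoidingZ G lam (insert v D)) := by
            refine mul_le_mul_of_nonneg_right ?_ (by positivity)
            exact_mod_cast (Finset.card_le_card fun w hw => by
              simp only [nbrsOutside, Finset.mem_filter] at hw ⊢
              exact ⟨hw.1, hw.2.1⟩).trans (hdeg v)
        _ = _ := by ring
    rw [← Finset.sum_div, div_mul_eq_mul_div, div_le_iff₀ hZ]
    have hrec := avoidingZ_eq G lam D hv
    rw [hrec]
    linarith

theorem condDistMap_eq_avoidingDist (G : SimpleGraph V) {lam c : ℝ} (hc : c ≠ 0) (D : Finset V)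
    (p : Finset (Sym2 V) → Prop) (f : Finset (Sym2 V) → Finset (Sym2 V))
    (h : ∀ N, ∑ M ∈ ((matchings G).filter p).filter (fun M => f M = N), lam ^ M.card =
      c * if N ∈ avoiding G D then lam ^ N.card else 0) :
    condDistMap G lam p f = avoidingDist G lam D := by
  have hden : ∑ M ∈ (matchings G).filter p, lam ^ M.card = c * avoidingZ G lam D := by
    rw [← Finset.sum_fiberwise _ f, Finset.sum_congr rfl fun N _ => h N, ← Finset.mul_sum,
      Finset.sum_ite_mem, Finset.univ_inter, avoidingZ]
  funext N
  rw [condDistMap, h N, hden, avoidingDist, mul_div_mul_left _ _ hc]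

theorem eq_of_degr_eq_one {G : SimpleGraph V} {u v w : V} (hu : degr G u = 1)
    (hv : G.Adj u v) (hw : G.Adj u w) : w = v := by
  unfold degr at hu
  obtain ⟨x, hx⟩ := Finset.card_eq_one.1 hu
  have h1 : v ∈ ({x} : Finset V) := hx ▸ by simpa using hv
  have h2 : w ∈ ({x} : Finset V) := hx ▸ by simpa using hw
  rw [Finset.mem_singleton] at h1 h2
  rw [h1, h2]

theorem condDistMap_erase_eq (G : SimpleGraph V) {lam : ℝ} (hlam : 0 < lam) {u v : V}
    (huv : G.Adj u v) :
    condDistMap G lam (fun M => s(u, v) ∈ M) (fun M => M.erase s(u, v)) =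
      avoidingDist G lam {v, u} := by
  refine condDistMap_eq_avoidingDist G hlam.ne' _ _ _ fun N => ?_
  split_ifs with hN
  · have hnot : s(u, v) ∉ N := not_mem_of_avoiding hN (by simp)
    rw [mem_avoiding] at hN
    refine (Finset.sum_congr (s₂ := {insert s(u, v) N}) ?_ fun _ _ => rfl).trans ?_
    · ext M
      simp only [matchings, Finset.mem_filter, Finset.mem_univ, true_and, Finset.mem_singleton]
      constructor
      · rintro ⟨⟨-, h⟩, rfl⟩
        exact (Finset.insert_erase h).symm
      · rintro rfl
        exact ⟨⟨hN.1.insert_edge huv (fun e he => hN.2 e he u (by simp))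
          (fun e he => hN.2 e he v (by simp)), Finset.mem_insert_self _ _⟩,
          Finset.erase_insert hnot⟩
    · rw [Finset.sum_singleton, Finset.card_insert_of_notMem hnot, pow_succ']
  · rw [mul_zero]
    refine Finset.sum_eq_zero fun M hM => absurd ?_ hN
    simp only [matchings, Finset.mem_filter, Finset.mem_univ, true_and] at hM
    obtain ⟨⟨hM, hmem⟩, rfl⟩ := hM
    rw [mem_avoiding]
    refine ⟨hM.subset (Finset.erase_subset _ _), fun e he x hx hxe => ?_⟩
    obtain ⟨hne, heM⟩ := Finset.mem_erase.1 he
    refine hM.2 e heM _ hmem hne x hxe (Sym2.mem_iff.2 ?_)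
    simpa [or_comm] using hx

theorem condDist_notMem_eq (G : SimpleGraph V) (lam : ℝ) {u v : V} (huv : G.Adj u v)
    (hu : degr G u = 1) :
    condDist G lam (fun M => s(u, v) ∉ M) = avoidingDist G lam {u} := by
  refine condDistMap_eq_avoidingDist G one_ne_zero _ _ _ fun N => ?_
  have hiff : N ∈ avoiding G {u} ↔ N ∈ matchings G ∧ s(u, v) ∉ N := by
    constructor
    · intro hN
      exact ⟨(Finset.mem_filter.1 hN).1, not_mem_of_avoiding hN (by simp)⟩
    · rintro ⟨hN, hnot⟩
      refine Finset.mem_filter.2 ⟨hN, fun e he x hx hxe => hnot ?_⟩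
      obtain rfl := Finset.mem_singleton.1 hx
      obtain ⟨w, rfl⟩ := hxe
      have hw : G.Adj x w := (Finset.mem_filter.1 hN).2.1 _ he
      rwa [eq_of_degr_eq_one hu huv hw] at he
  simp only [id]
  rw [one_mul, Finset.sum_filter, Finset.sum_ite_eq']
  simp only [hiff, Finset.mem_filter]

/-- for a pendant edge `i`, there is a coupling of the conditional law of
`M∖{i}` given `i ∈ M` and the conditional law of `M` given `i ∉ M` with expected
edge-Hamming distance at most `λΔ`. -/
theorem stmt_9 {V : Type*} [Fintype V] [DecidableEq V]
    (G : SimpleGraph V) (Δ : ℕ) (hΔ : 1 ≤ Δ) (hdeg : ∀ v : V, degr G v ≤ Δ)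
    (lam : ℝ) (hlam : 0 < lam)
    (i : Sym2 V) (hi : i ∈ G.edgeSet) (hpend : ∃ u : V, u ∈ i ∧ degr G u = 1) :
    ∃ π : Finset (Sym2 V) × Finset (Sym2 V) → ℝ,
      IsCoupling π (condDistMap G lam (fun M => i ∈ M) (fun M => M.erase i))
        (condDist G lam (fun M => i ∉ M)) ∧
      ∑ q : Finset (Sym2 V) × Finset (Sym2 V), π q * (edist q.1 q.2 : ℝ) ≤
        lam * (Δ : ℝ) := by
  obtain ⟨u, ⟨v, rfl⟩, hu⟩ := hpend
  have huv : G.Adj u v := hi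
  rw [condDistMap_erase_eq G hlam huv, condDist_notMem_eq G lam huv hu]
  exact exists_coupling_avoiding G Δ hdeg hlam {u} (by simpa using huv.ne')

end SensMatching
end
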